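/- Let A and B be commutative rings, f : A → B a ring homomorphism satisfying the going-down property, J an ideal of B, and 𝒜 a non-empty class of ideals of A. If A⋈^f J is Cohen-Macaulay in the sense of 𝒜^e := { 𝔞^e : 𝔞 ∈ 𝒜 }, then A is Cohen-Macaulay in the sense of 𝒜 and kgr_A(𝔞, J) ≥ height 𝔞 for every 𝔞 ∈ 𝒜. -/

import Mathlib

/-- The Koszul cochain differential of the complex `Hom(K_•(x), M)`, described explicitly:
the degree-`i` term is the module of `M`-valued functions on the `i`-element subsets of
`Fin n`, and the differential is the usual alternating-sum formula. -/
noncomputable def koszulMap (A : Type*) [CommRing A] (M : Type*) [AddCommGroup M]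
    [Module A M] {n : ℕ} (x : Fin n → A) (i : ℕ) :
    ({s : Finset (Fin n) // s.card = i} → M) →ₗ[A]
      ({s : Finset (Fin n) // s.card = i + 1} → M) where
  toFun g t := ∑ j ∈ t.1.attach,
    (((-1 : A) ^ ((t.1.filter (fun k => k < j.1)).card)) * x j.1) •
      g ⟨t.1.erase j.1, by
        rw [Finset.card_erase_of_mem j.2, t.2]; omega⟩

  map_add' g h := funext fun t => by
    simp [smul_add, Finset.sum_add_distrib]
  map_smul' a g := funext fun t => by
    simp only [Pi.smul_apply, RingHom.id_apply, Finset.smul_sum]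
    exact Finset.sum_congr rfl fun j _ => by
      rw [smul_smul, smul_smul, mul_comm]

/-- Nonvanishing of the `i`-th cohomology `H^i(Hom(K_•(x), M))` of the Koszul
cochain complex. -/
def koszulCohomologyNeZero (A : Type*) [CommRing A] (M : Type*) [AddCommGroup M]
    [Module A M] {n : ℕ} (x : Fin n → A) : ℕ → Prop
  | 0 => LinearMap.ker (koszulMap A M x 0) ≠ ⊥
  | (i + 1) => ¬ (LinearMap.ker (koszulMap A M x (i + 1)) ≤
      LinearMap.range (koszulMap A M x i))

/-- The Koszul grade of a finite sequence `x` on `M`: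
`inf { i : H^i(Hom(K_•(x), M)) ≠ 0 }` (an element of `ℕ∞`, equal to `⊤` if all
cohomology vanishes). -/
noncomputable def kgrSeq (A : Type*) [CommRing A] (M : Type*) [AddCommGroup M]
    [Module A M] {n : ℕ} (x : Fin n → A) : ℕ∞ :=
  sInf {i : ℕ∞ | ∃ k : ℕ, i = k ∧ koszulCohomologyNeZero A M x k}

/-- The Koszul grade `kgr_A(𝔞, M)` of an arbitrary ideal `𝔞` on `M`: the supremum of the
Koszul grades of finite sequences contained in `𝔞` (equivalently, of the finitely
generated subideals of `𝔞`). -/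
noncomputable def kgr (A : Type*) [CommRing A] (𝔞 : Ideal A) (M : Type*)
    [AddCommGroup M] [Module A M] : ℕ∞ :=
  ⨆ (n : ℕ) (x : Fin n → A) (_ : ∀ j, x j ∈ 𝔞), kgrSeq A M x

/-- The height of an ideal: the infimum of the heights of the primes containing it. -/
noncomputable def idealHeight (A : Type*) [CommRing A] (𝔞 : Ideal A) : ℕ∞ :=
  ⨅ (p : PrimeSpectrum A) (_ : 𝔞 ≤ p.asIdeal), Order.height p

/-- A commutative ring `R` is Cohen-Macaulay in the sense of a class `𝒜` of ideals if
`height 𝔞 = kgr_R(𝔞, R)` for every `𝔞 ∈ 𝒜`. -/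
def IsCMSense (R : Type*) [CommRing R] (𝒜 : Set (Ideal R)) : Prop :=
  ∀ 𝔞 ∈ 𝒜, idealHeight R 𝔞 = kgr R 𝔞 R

/-- Cohen-Macaulay in the sense of ideals. -/
def IsCMIdeals (R : Type*) [CommRing R] : Prop :=
  ∀ 𝔞 : Ideal R, idealHeight R 𝔞 = kgr R 𝔞 R

/-- Cohen-Macaulay in the sense of maximal ideals. -/
def IsCMMaximal (R : Type*) [CommRing R] : Prop :=
  ∀ 𝔪 : Ideal R, 𝔪.IsMaximal → idealHeight R 𝔪 = kgr R 𝔪 R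

/-- The amalgamation `A ⋈^f J = {(a, f a + j) : a ∈ A, j ∈ J}` of `A` with `B` along the
ideal `J` of `B` with respect to `f : A →+* B`, as a subring of `A × B`. -/
def amalgamation {A B : Type*} [CommRing A] [CommRing B] (f : A →+* B) (J : Ideal B) :
    Subring (A × B) where
  carrier := {p | p.2 - f p.1 ∈ J}
  zero_mem' := by simp
  one_mem' := by simp
  add_mem' := fun {p q} hp hq => by
    have := J.add_mem hp hq
    simpa [add_sub_add_comm] using this
  neg_mem' := fun {p} hp => by
    show (-p).2 - f ((-p).1) ∈ J
    have key : (-p).2 - f ((-p).1) = -(p.2 - f p.1) := by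
      simp only [Prod.fst_neg, Prod.snd_neg, map_neg]; ring
    rw [key]
    exact J.neg_mem hp
  mul_mem' := fun {p q} hp hq => by
    show (p * q).2 - f ((p * q).1) ∈ J
    have key : (p * q).2 - f ((p * q).1)
        = p.2 * (q.2 - f q.1) + (p.2 - f p.1) * f q.1 := by
      simp only [Prod.fst_mul, Prod.snd_mul, map_mul]; ring
    rw [key]
    exact J.add_mem (J.mul_mem_left _ hq) (J.mul_mem_right _ hp)

/-- The natural embedding `ι_A : A → A ⋈^f J`, `a ↦ (a, f a)`. -/
def amalgIota {A B : Type*} [CommRing A] [CommRing B] (f : A →+* B) (J : Ideal B) :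
    A →+* amalgamation f J where
  toFun a := ⟨(a, f a), show (a, f a).2 - f (a, f a).1 ∈ J by simp⟩
  map_one' := Subtype.ext (by simp)
  map_mul' a b := Subtype.ext (by simp)
  map_zero' := Subtype.ext (by simp)
  map_add' a b := Subtype.ext (by simp)

/-- The extension `𝔞^e = 𝔞(A ⋈^f J)` of an ideal `𝔞` of `A` along `ι_A`. -/
noncomputable def idealExt {A B : Type*} [CommRing A] [CommRing B] (f : A →+* B)
    (J : Ideal B) (𝔞 : Ideal A) : Ideal ↥(amalgamation f J) :=
  Ideal.map (amalgIota f J) 𝔞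

/-- `kgr_A(𝔞, J)` where the ideal `J` of `B` is viewed as an `A`-module via `f`. -/
noncomputable def kgrIdeal {A B : Type*} [CommRing A] [CommRing B] (f : A →+* B)
    (J : Ideal B) (𝔞 : Ideal A) : ℕ∞ :=
  letI : Module A J := Module.compHom J f
  kgr A 𝔞 J

/-- The ideal `𝔭'^f = 𝔭 ⋈^f J = {(p, f p + j) : p ∈ 𝔭, j ∈ J}` of `A ⋈^f J`. -/
def primeAmalg {A B : Type*} [CommRing A] [CommRing B] (f : A →+* B) (J : Ideal B)
    (𝔭 : Ideal A) : Ideal ↥(amalgamation f J) where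
  carrier := {z | (z : A × B).1 ∈ 𝔭}
  zero_mem' := by simp
  add_mem' := fun {a b} ha hb => 𝔭.add_mem ha hb
  smul_mem' := fun c {z} hz => 𝔭.mul_mem_left (c : A × B).1 hz

/-- The ideal `𝔮̄^f = {(a, f a + j) : a ∈ A, j ∈ J, f a + j ∈ 𝔮}` of `A ⋈^f J`. -/
def qbarAmalg {A B : Type*} [CommRing A] [CommRing B] (f : A →+* B) (J : Ideal B)
    (𝔮 : Ideal B) : Ideal ↥(amalgamation f J) where
  carrier := {z | (z : A × B).2 ∈ 𝔮}
  zero_mem' := by simp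
  add_mem' := fun {a b} ha hb => 𝔮.add_mem ha hb
  smul_mem' := fun c {z} hz => 𝔮.mul_mem_left (c : A × B).2 hz

/-- A ring homomorphism `f : A →+* B` satisfies the going-down property. -/
def RingHom.GoesDown {A B : Type*} [CommRing A] [CommRing B] (f : A →+* B) : Prop :=
  ∀ (𝔭' 𝔭 : Ideal A), 𝔭'.IsPrime → 𝔭.IsPrime → 𝔭' ≤ 𝔭 →
    ∀ 𝔮 : Ideal B, 𝔮.IsPrime → 𝔮.comap f = 𝔭 →
      ∃ 𝔮' : Ideal B, 𝔮'.IsPrime ∧ 𝔮' ≤ 𝔮 ∧ 𝔮'.comap f = 𝔭'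

/-- A module with an endomorphism `d` and a `ℤ`-indexed family of submodules, thought of as the
total space of a cochain complex. -/
structure GradedDiff (A : Type*) [CommRing A] where
  /-- The total space. -/
  carrier : Type*
  [grp : AddCommGroup carrier]
  [mod : Module A carrier]
  /-- The differential. -/
  d : carrier →ₗ[A] carrier
  /-- The homogeneous components. -/
  deg : ℤ → Submodule A carrier

attribute [instance] GradedDiff.grp GradedDiff.mod

namespace GradedDiff

variable {A : Type*} [CommRing A]

/-- Every cocycle of degree `i` becomes a coboundary after multiplication by an element of `S`. -/
def ExactAt (S : Submonoid A) (C : GradedDiff A) (i : ℤ) : Prop :=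
  ∀ g ∈ C.deg i, C.d g = 0 → ∃ s ∈ S, ∃ h ∈ C.deg (i - 1), C.d h = s • g

/-- The (shifted) mapping cone of multiplication by `z`. -/
def cone (z : A) (C : GradedDiff A) : GradedDiff A where
  carrier := C.carrier × C.carrier
  d := (C.d ∘ₗ LinearMap.fst A _ _).prod
    (z • LinearMap.fst A _ _ - C.d ∘ₗ LinearMap.snd A _ _)
  deg i := (C.deg i).prod (C.deg (i - 1))

theorem mem_cone_deg {z : A} {C : GradedDiff A} {i : ℤ} {g : C.carrier × C.carrier} :
    g ∈ (cone z C).deg i ↔ g.1 ∈ C.deg i ∧ g.2 ∈ C.deg (i - 1) := Iff.rfl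

/-- Isomorphisms compatible with the differentials and the degrees. -/
structure Iso (C D : GradedDiff A) where
  /-- The underlying linear equivalence. -/
  e : C.carrier ≃ₗ[A] D.carrier
  comm : ∀ g, e (C.d g) = D.d (e g)
  mem_iff : ∀ i g, e g ∈ D.deg i ↔ g ∈ C.deg i

/-- The identity isomorphism. -/
def Iso.refl (C : GradedDiff A) : Iso C C :=
  ⟨LinearEquiv.refl A _, fun _ => rfl, fun _ _ => Iff.rfl⟩

/-- Composition of isomorphisms. -/
def Iso.trans {C D E : GradedDiff A} (φ : Iso C D) (ψ : Iso D E) : Iso C E where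
  e := φ.e.trans ψ.e
  comm g := by simp [φ.comm, ψ.comm]
  mem_iff i g := by simp [φ.mem_iff, ψ.mem_iff]

/-- The inverse isomorphism. -/
def Iso.symm {C D : GradedDiff A} (φ : Iso C D) : Iso D C where
  e := φ.e.symm
  comm g := by rw [LinearEquiv.symm_apply_eq, φ.comm, LinearEquiv.apply_symm_apply]
  mem_iff i g := by rw [← φ.mem_iff, LinearEquiv.apply_symm_apply]

/-- Cones of isomorphic complexes are isomorphic. -/
def Iso.cone {C D : GradedDiff A} (z : A) (φ : Iso C D) : Iso (cone z C) (cone z D) where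
  e := φ.e.prodCongr φ.e
  comm := by
    rintro ⟨a, b⟩
    refine Prod.ext (φ.comm a) ?_
    change φ.e (z • a - C.d b) = z • φ.e a - D.d (φ.e b)
    rw [map_sub, map_smul, φ.comm]
  mem_iff i g := and_congr (φ.mem_iff _ _) (φ.mem_iff _ _)

/-- Iterated cones commute up to isomorphism. -/
def Iso.swap (y z : A) (C : GradedDiff A) :
    Iso (GradedDiff.cone y (GradedDiff.cone z C)) (GradedDiff.cone z (GradedDiff.cone y C)) where
  e := (LinearEquiv.prodProdProdComm A C.carrier C.carrier C.carrier C.carrier).trans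
    ((LinearEquiv.refl A (C.carrier × C.carrier)).prodCongr
      ((LinearEquiv.refl A C.carrier).prodCongr (LinearEquiv.neg A)))
  comm := by
    rintro ⟨⟨a, b⟩, ⟨c, e⟩⟩
    change (((C.d a, y • a - C.d c), (z • a - C.d b, -(y • b - (z • c - C.d e)))) :
      (C.carrier × C.carrier) × (C.carrier × C.carrier)) =
      ((C.d a, y • a - C.d c), (z • a - C.d b, z • c - (y • b - C.d (-e))))
    rw [map_neg]
    congr 3
    abel
  mem_iff := by
    rintro i ⟨⟨a, b⟩, ⟨c, e⟩⟩
    change ((a ∈ C.deg i ∧ c ∈ C.deg (i - 1)) ∧ (b ∈ C.deg (i - 1) ∧ -e ∈ C.deg (i - 1 - 1))) ↔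
      ((a ∈ C.deg i ∧ b ∈ C.deg (i - 1)) ∧ (c ∈ C.deg (i - 1) ∧ e ∈ C.deg (i - 1 - 1)))
    rw [neg_mem_iff]
    tauto

theorem exactAt_bot_iff {C : GradedDiff A} {i : ℤ} :
    C.ExactAt ⊥ i ↔ ∀ g ∈ C.deg i, C.d g = 0 → ∃ h ∈ C.deg (i - 1), C.d h = g := by
  simp [ExactAt, Submonoid.mem_bot]

theorem ExactAt.of_iso {S : Submonoid A} {C D : GradedDiff A} (φ : Iso C D) {i : ℤ}
    (hC : ExactAt S C i) : ExactAt S D i := by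
  intro g hg hdg
  obtain ⟨s, hs, h, hh, hd⟩ := hC (φ.symm.e g) ((φ.symm.mem_iff _ _).2 hg)
    (by rw [← φ.symm.comm, hdg, map_zero])
  refine ⟨s, hs, φ.e h, (φ.mem_iff _ _).2 hh, ?_⟩
  rw [← φ.comm, hd, map_smul]
  exact congrArg (s • ·) (φ.e.apply_symm_apply g)

theorem ExactAt.cone {S : Submonoid A} {C : GradedDiff A} {i : ℤ} (z : A)
    (hi : ExactAt S C i) (hi' : ExactAt S C (i - 1)) : ExactAt S (cone z C) i := by
  rintro ⟨g, g'⟩ ⟨hg, hg'⟩ hd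
  obtain ⟨hd₁, hd₂⟩ := Prod.ext_iff.1 hd
  change C.d g = 0 at hd₁
  change z • g - C.d g' = 0 at hd₂
  obtain ⟨s, hs, a, ha, hda⟩ := hi g hg hd₁
  obtain ⟨t, ht, b, hb, hdb⟩ := hi' (z • a - s • g')
    (sub_mem (Submodule.smul_mem _ _ ha) (Submodule.smul_mem _ _ hg'))
    (by rw [map_sub, map_smul, map_smul, hda, smul_comm z s, ← smul_sub, hd₂, smul_zero])
  refine ⟨t * s, mul_mem ht hs, (t • a, b), ⟨Submodule.smul_mem _ _ ha, hb⟩, ?_⟩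
  refine Prod.ext ?_ ?_
  · change C.d (t • a) = (t * s) • g
    rw [map_smul, hda, mul_smul]
  · change z • t • a - C.d b = (t * s) • g'
    rw [hdb, smul_sub, smul_comm z t, mul_smul, sub_sub_cancel]

/-- Multiplication by `w` is homotopic to zero. -/
def NullHomotopic (w : A) (C : GradedDiff A) : Prop :=
  ∃ h : C.carrier →ₗ[A] C.carrier, (∀ i, ∀ g ∈ C.deg i, h g ∈ C.deg (i - 1)) ∧
    ∀ g, C.d (h g) + h (C.d g) = w • g

theorem NullHomotopic.cone {w : A} {C : GradedDiff A} (z : A) (hw : NullHomotopic w C) :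
    NullHomotopic w (cone z C) := by
  obtain ⟨h, hdeg, hh⟩ := hw
  refine ⟨h.prodMap (-h), fun i g hg => ⟨hdeg _ _ hg.1, neg_mem (hdeg _ _ hg.2)⟩, ?_⟩
  rintro ⟨a, b⟩
  refine Prod.ext (hh a) ?_
  change z • h a - C.d (-h b) + -h (z • a - C.d b) = w • b
  rw [← hh b, map_neg, map_sub, map_smul]
  abel

theorem nullHomotopic_cone_self (z : A) (C : GradedDiff A) : NullHomotopic z (cone z C) := by
  refine ⟨(LinearMap.snd A C.carrier C.carrier).prod 0, fun i g hg => ⟨hg.2, zero_mem _⟩, ?_⟩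
  rintro ⟨a, b⟩
  refine Prod.ext ?_ ?_
  · change C.d b + (z • a - C.d b) = z • a
    abel
  · change z • b - C.d 0 + 0 = z • b
    simp

theorem ExactAt.of_cone {S : Submonoid A} {C : GradedDiff A} {i : ℤ} {z s : A} {N : ℕ}
    (hs : s ∈ S) (hnull : NullHomotopic (s * z ^ N) C) (hex : ExactAt S (GradedDiff.cone z C) i) :
    ExactAt S C i := by
  obtain ⟨h, hdeg, hh⟩ := hnull
  intro g hg hdg
  have key : ∀ N : ℕ, ∀ s ∈ S, (∃ h ∈ C.deg (i - 1), C.d h = (s * z ^ N) • g) →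
      ∃ s ∈ S, ∃ h ∈ C.deg (i - 1), C.d h = s • g := by
    intro N
    induction N with
    | zero =>
      rintro s hs ⟨h, hh, hd⟩
      exact ⟨s, hs, h, hh, by simpa using hd⟩
    | succ N ih =>
      rintro s hs ⟨h, hh, hd⟩
      obtain ⟨t, ht, a, ha, hda⟩ := hex ((s * z ^ N) • g, h) ⟨Submodule.smul_mem _ _ hg, hh⟩ <| by
        refine Prod.ext ?_ ?_
        · change C.d ((s * z ^ N) • g) = 0
          rw [map_smul, hdg, smul_zero]
        · change z • (s * z ^ N) • g - C.d h = 0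
          rw [hd, smul_smul, sub_eq_zero]
          congr 1
          ring
      refine ih (t * s) (mul_mem ht hs) ⟨a.1, ha.1, ?_⟩
      have := congrArg Prod.fst hda
      change C.d a.1 = t • (s * z ^ N) • g at this
      rw [this, smul_smul, mul_assoc]
  refine key N s hs ⟨h g, hdeg _ _ hg, ?_⟩
  rw [← hh g, hdg, map_zero, add_zero]

/-- The Koszul complex of a list of elements with coefficients in a complex. -/
def koszul (C : GradedDiff A) (l : List A) : GradedDiff A := l.foldr cone C

/-- Coefficients in a cone can be moved outside. -/
def koszulConeIso (C : GradedDiff A) (y : A) : (l : List A) →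
    Iso (cone y (koszul C l)) (koszul (cone y C) l)
  | [] => Iso.refl _
  | z :: l => (Iso.swap y z (koszul C l)).trans ((koszulConeIso C y l).cone z)

theorem exactAt_koszul_koszul {S : Submonoid A} {C : GradedDiff A} {n : ℤ} {l : List A}
    (h : ∀ i ≤ n, ExactAt S (koszul C l) i) (y : List A) :
    ∀ i ≤ n, ExactAt S (koszul (koszul C y) l) i := by
  induction y with
  | nil => exact h
  | cons a y ih =>
    exact fun i hi => ((ih i hi).cone a (ih (i - 1) (by lia))).of_iso (koszulConeIso _ a l)

theorem nullHomotopic_koszul_of_mem_span (C : GradedDiff A) {l : List A} {w : A}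
    (hw : w ∈ Ideal.span {a | a ∈ l}) : NullHomotopic w (koszul C l) := by
  induction hw using Submodule.span_induction with
  | mem a ha =>
    induction l with
    | nil => simp at ha
    | cons z l ih =>
      rcases List.mem_cons.1 ha with rfl | ha
      · exact nullHomotopic_cone_self _ _
      · exact (ih ha).cone z
  | zero => exact ⟨0, fun i g _ => zero_mem _, fun g => by simp⟩
  | add a b _ _ ha hb =>
    obtain ⟨h, hdeg, hh⟩ := ha
    obtain ⟨k, kdeg, hk⟩ := hb
    refine ⟨h + k, fun i g hg => add_mem (hdeg i g hg) (kdeg i g hg), fun g => ?_⟩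
    rw [add_smul, ← hh, ← hk]
    simp only [LinearMap.add_apply, map_add]
    abel
  | smul c a _ ha =>
    obtain ⟨h, hdeg, hh⟩ := ha
    refine ⟨c • h, fun i g hg => Submodule.smul_mem _ _ (hdeg i g hg), fun g => ?_⟩
    rw [smul_eq_mul, mul_smul, ← hh]
    simp

theorem exactAt_of_exactAt_koszul {S : Submonoid A} {C : GradedDiff A} {i : ℤ} {l : List A}
    (hl : ∀ a ∈ l, ∃ s ∈ S, ∃ N : ℕ, NullHomotopic (s * a ^ N) C)
    (h : ExactAt S (koszul C l) i) : ExactAt S C i := by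
  induction l with
  | nil => exact h
  | cons a l ih =>
    obtain ⟨s, hs, N, hN⟩ := hl a List.mem_cons_self
    refine ih (fun b hb => hl b (List.mem_cons_of_mem _ hb)) (ExactAt.of_cone hs (N := N) ?_ h)
    clear hl ih h
    induction l with
    | nil => exact hN
    | cons b l ih => exact ih.cone b

/-- Koszul grade is monotone in the ideal, up to radicals and localization. -/
theorem exactAt_koszul_of_mem_radical {S : Submonoid A} {C : GradedDiff A} {n : ℤ} {l y : List A}
    (hl : ∀ a ∈ l, ∃ s ∈ S, ∃ N : ℕ, s * a ^ N ∈ Ideal.span {b | b ∈ y})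
    (h : ∀ i ≤ n, ExactAt S (koszul C l) i) : ∀ i ≤ n, ExactAt S (koszul C y) i := fun i hi =>
  exactAt_of_exactAt_koszul (fun a ha =>
    let ⟨s, hs, N, hN⟩ := hl a ha
    ⟨s, hs, N, nullHomotopic_koszul_of_mem_span C hN⟩) (exactAt_koszul_koszul h y i hi)

/-- A module seen as a complex concentrated in degree zero. -/
def single (A : Type*) [CommRing A] (M : Type*) [AddCommGroup M] [Module A M] : GradedDiff A where
  carrier := M
  d := 0
  deg i := ⨅ _ : i ≠ 0, ⊥

theorem mem_single_deg {M : Type*} [AddCommGroup M] [Module A M] {i : ℤ} {m : M} :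
    m ∈ (single A M).deg i ↔ (i ≠ 0 → m = 0) := by
  change m ∈ (⨅ _ : i ≠ 0, (⊥ : Submodule A M)) ↔ _
  simp [Submodule.mem_iInf]

/-- There is a functional on `C` which sends coboundaries to `I` and takes the value `1` at some
cocycle of degree `n`. -/
def HasTop (C : GradedDiff A) (I : Ideal A) (n : ℤ) : Prop :=
  ∃ top : C.carrier →ₗ[A] A, (∀ g, top (C.d g) ∈ I) ∧ ∃ g ∈ C.deg n, C.d g = 0 ∧ top g = 1

theorem hasTop_single : HasTop (single A A) ⊥ 0 := by
  change ∃ top : A →ₗ[A] A, _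
  refine ⟨LinearMap.id, fun g => zero_mem _, (1 : A), ?_, rfl, rfl⟩
  exact (mem_single_deg (A := A) (M := A)).2 (by simp)

theorem HasTop.cone {C : GradedDiff A} {I I' : Ideal A} {n : ℤ} {z : A} (h : HasTop C I n)
    (hz : z ∈ I') (hI : I ≤ I') : HasTop (cone z C) I' (n + 1) := by
  obtain ⟨top, htop, g, hg, hd, h1⟩ := h
  refine ⟨top ∘ₗ LinearMap.snd A C.carrier C.carrier, ?_, ((0, g) : C.carrier × C.carrier),
    mem_cone_deg.2 ⟨zero_mem _, by simpa using hg⟩, Prod.ext (map_zero C.d) ?_, h1⟩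
  · rintro ⟨a, b⟩
    change top (z • a - C.d b) ∈ I'
    rw [map_sub, map_smul]
    exact sub_mem (Ideal.mul_mem_right _ _ hz) (hI (htop b))
  · change z • (0 : C.carrier) - C.d g = 0
    rw [hd, smul_zero, sub_zero]

theorem hasTop_koszul (l : List A) :
    HasTop (koszul (single A A) l) (Ideal.span {a | a ∈ l}) l.length := by
  induction l with
  | nil =>
    obtain ⟨top, htop, h⟩ := hasTop_single (A := A)
    exact ⟨top, fun g => bot_le (a := Ideal.span {a | a ∈ []}) (htop g), h⟩
  | cons z l ih =>
    rw [List.length_cons, Nat.cast_add, Nat.cast_one]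
    exact ih.cone (Ideal.subset_span List.mem_cons_self)
      (Ideal.span_mono fun a ha => List.mem_cons_of_mem _ ha)

theorem exists_mem_span_of_exactAt_koszul {S : Submonoid A} {l : List A}
    (h : ExactAt S (koszul (single A A) l) l.length) : ∃ s ∈ S, s ∈ Ideal.span {a | a ∈ l} := by
  obtain ⟨top, htop, g, hg, hd, h1⟩ := hasTop_koszul l
  obtain ⟨s, hs, b, -, hb⟩ := h g hg hd
  refine ⟨s, hs, ?_⟩
  simpa [hb, h1] using htop b

/-- The Koszul cochain complex of a finite sequence, as functions on all finite subsets. -/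
def koszulFun {n : ℕ} (M : Type*) [AddCommGroup M] [Module A M] (x : Fin n → A) :
    GradedDiff A where
  carrier := Finset (Fin n) → M
  d :=
    { toFun := fun g t => ∑ j ∈ t,
        (((-1 : A) ^ ((t.filter (fun k => k < j)).card)) * x j) • g (t.erase j)
      map_add' := fun g h => funext fun t => by simp [smul_add, Finset.sum_add_distrib]
      map_smul' := fun a g => funext fun t => by
        simp only [Pi.smul_apply, RingHom.id_apply, Finset.smul_sum]
        exact Finset.sum_congr rfl fun j _ => smul_comm _ _ _ }
  deg i :=
    { carrier := {g | ∀ t, (t.card : ℤ) ≠ i → g t = 0}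
      add_mem' := fun {g h} hg hh t ht => by simp [hg t ht, hh t ht]
      zero_mem' := fun _ _ => rfl
      smul_mem' := fun a g hg t ht => by simp [hg t ht] }

theorem koszulFun_d_apply {n : ℕ} {M : Type*} [AddCommGroup M] [Module A M] (x : Fin n → A)
    (g : Finset (Fin n) → M) (t : Finset (Fin n)) :
    (show Finset (Fin n) → M from (koszulFun M x).d g) t = ∑ j ∈ t,
      (((-1 : A) ^ ((t.filter (fun k => k < j)).card)) * x j) • g (t.erase j) := rfl

theorem mem_koszulFun_deg {n : ℕ} {M : Type*} [AddCommGroup M] [Module A M] {x : Fin n → A}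
    {i : ℤ} {g : Finset (Fin n) → M} :
    g ∈ (koszulFun M x).deg i ↔ ∀ t : Finset (Fin n), (t.card : ℤ) ≠ i → g t = 0 := Iff.rfl

end GradedDiff

section FinsetFin

variable {n : ℕ}

/-- Shift a finite subset of `Fin n` by one. -/
def Finset.succFin (s : Finset (Fin n)) : Finset (Fin (n + 1)) := s.map (Fin.succEmb n)

/-- The inverse of `Finset.succFin`, ignoring the element `0`. -/
def Finset.predFin (t : Finset (Fin (n + 1))) : Finset (Fin n) := {k | k.succ ∈ t}

@[simp]
theorem Finset.succ_mem_succFin {s : Finset (Fin n)} {k : Fin n} : k.succ ∈ s.succFin ↔ k ∈ s := by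
  simp [Finset.succFin]

@[simp]
theorem Finset.zero_notMem_succFin {s : Finset (Fin n)} : 0 ∉ s.succFin := by
  simp [Finset.succFin, Fin.succ_ne_zero]

@[simp]
theorem Finset.card_succFin {s : Finset (Fin n)} : s.succFin.card = s.card := Finset.card_map _

@[simp]
theorem Finset.mem_predFin {t : Finset (Fin (n + 1))} {k : Fin n} : k ∈ t.predFin ↔ k.succ ∈ t := by
  simp [Finset.predFin]

@[simp]
theorem Finset.predFin_succFin (s : Finset (Fin n)) : s.succFin.predFin = s := by ext; simp

@[simp]
theorem Finset.predFin_insert_zero (t : Finset (Fin (n + 1))) :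
    (insert 0 t).predFin = t.predFin := by
  ext; simp [Fin.succ_ne_zero]

theorem Finset.succFin_predFin {t : Finset (Fin (n + 1))} (h : 0 ∉ t) : t.predFin.succFin = t := by
  ext k
  cases k using Fin.cases <;> simp [h]

theorem Finset.insert_succFin_predFin {t : Finset (Fin (n + 1))} (h : 0 ∈ t) :
    insert 0 t.predFin.succFin = t := by
  ext k
  cases k using Fin.cases <;> simp [h, Fin.succ_ne_zero]

theorem Finset.succFin_erase (s : Finset (Fin n)) (k : Fin n) :
    (s.erase k).succFin = s.succFin.erase k.succ := by
  ext j
  cases j using Fin.cases <;> simp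

theorem Finset.sum_succFin {M : Type*} [AddCommMonoid M] (s : Finset (Fin n))
    (F : Fin (n + 1) → M) : ∑ j ∈ s.succFin, F j = ∑ j ∈ s, F j.succ := Finset.sum_map _ _ _

theorem Finset.card_filter_lt_succFin (s : Finset (Fin n)) (k : Fin n) :
    (s.succFin.filter (fun j => j < k.succ)).card = (s.filter (fun j => j < k)).card := by
  rw [← Finset.card_succFin (s := s.filter (fun j => j < k))]
  congr 1
  ext j
  cases j using Fin.cases <;> simp [Finset.succFin]

theorem Finset.card_filter_lt_insert_succFin (s : Finset (Fin n)) (k : Fin n) :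
    ((insert 0 s.succFin).filter (fun j => j < k.succ)).card =
      (s.filter (fun j => j < k)).card + 1 := by
  rw [Finset.filter_insert, if_pos (Fin.succ_pos k), Finset.card_insert_of_notMem (by simp),
    Finset.card_filter_lt_succFin]

end FinsetFin

namespace GradedDiff

variable {A : Type*} [CommRing A]

/-- Splitting functions on finite subsets according to whether the subset contains `0`. -/
def splitZero (A : Type*) [CommRing A] (M : Type*) [AddCommGroup M] [Module A M] (n : ℕ) :
    (Finset (Fin (n + 1)) → M) ≃ₗ[A] (Finset (Fin n) → M) × (Finset (Fin n) → M) where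
  toFun g := (fun s => g s.succFin, fun s => g (insert 0 s.succFin))
  map_add' _ _ := rfl
  map_smul' _ _ := rfl
  invFun g t := if 0 ∈ t then g.2 t.predFin else g.1 t.predFin
  left_inv g := by
    funext t
    by_cases h : 0 ∈ t
    · simp [h, Finset.insert_succFin_predFin]
    · simp [h, Finset.succFin_predFin]
  right_inv g := by ext s <;> simp

/-- The Koszul complex of a sequence is the cone of the Koszul complex of its tail. -/
def koszulFunIso {n : ℕ} (M : Type*) [AddCommGroup M] [Module A M] (x : Fin (n + 1) → A) :
    Iso (koszulFun M x) (cone (x 0) (koszulFun M fun j => x j.succ)) where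
  e := splitZero A M n
  comm g := by
    refine Prod.ext ?_ ?_
    · funext s
      change ∑ j ∈ s.succFin, _ = ∑ j ∈ s, _
      rw [Finset.sum_succFin]
      refine Finset.sum_congr rfl fun j _ => ?_
      rw [Finset.card_filter_lt_succFin, ← Finset.succFin_erase]
      rfl
    · funext s
      change ∑ j ∈ insert 0 s.succFin, _ = x 0 • (show Finset (Fin (n + 1)) → M from g) s.succFin -
        ∑ j ∈ s, _
      rw [Finset.sum_insert Finset.zero_notMem_succFin, Finset.sum_succFin, sub_eq_add_neg,
        ← Finset.sum_neg_distrib]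
      congr 1
      · rw [Finset.erase_insert Finset.zero_notMem_succFin]
        simp
      · refine Finset.sum_congr rfl fun j _ => ?_
        rw [Finset.card_filter_lt_insert_succFin,
          Finset.erase_insert_of_ne (Fin.succ_ne_zero j).symm,
          ← Finset.succFin_erase, pow_succ, mul_neg_one, neg_mul, neg_smul]
        rfl
  mem_iff i g := by
    change ((∀ s : Finset (Fin n), (s.card : ℤ) ≠ i →
        (show Finset (Fin (n + 1)) → M from g) s.succFin = 0) ∧
      ∀ s : Finset (Fin n), (s.card : ℤ) ≠ i - 1 →
        (show Finset (Fin (n + 1)) → M from g) (insert 0 s.succFin) = 0) ↔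
      ∀ t : Finset (Fin (n + 1)), (t.card : ℤ) ≠ i →
        (show Finset (Fin (n + 1)) → M from g) t = 0
    constructor
    · rintro ⟨h₀, h₁⟩ t ht
      by_cases h : 0 ∈ t
      · rw [← Finset.insert_succFin_predFin h] at ht ⊢
        refine h₁ _ fun h => ht ?_
        rw [Finset.card_insert_of_notMem Finset.zero_notMem_succFin, Finset.card_succFin]
        lia
      · rw [← Finset.succFin_predFin h] at ht ⊢
        exact h₀ _ (by simpa using ht)
    · refine fun h => ⟨fun s hs => h _ (by simpa using hs), fun s hs => h _ fun h' => hs ?_⟩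
      rw [Finset.card_insert_of_notMem Finset.zero_notMem_succFin, Finset.card_succFin] at h'
      lia

/-- The Koszul complex of the empty sequence. -/
def koszulFunZeroIso (M : Type*) [AddCommGroup M] [Module A M] (x : Fin 0 → A) :
    Iso (koszulFun M x) (single A M) where
  e := LinearEquiv.funUnique (Finset (Fin 0)) A M
  comm g := rfl
  mem_iff i g := by
    change (LinearEquiv.funUnique (Finset (Fin 0)) A M g ∈ (single A M).deg i) ↔
      ∀ t : Finset (Fin 0), (t.card : ℤ) ≠ i → (show Finset (Fin 0) → M from g) t = 0
    rw [mem_single_deg]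
    constructor
    · intro h t ht
      obtain rfl := Subsingleton.elim t default
      exact h (by rintro rfl; exact ht (by simp [Finset.eq_empty_of_isEmpty]))
    · exact fun h hi => h default (by simpa [Finset.eq_empty_of_isEmpty] using hi.symm)

/-- The Koszul complex of a sequence as an iterated cone. -/
def koszulFunIsoKoszul (M : Type*) [AddCommGroup M] [Module A M] : {n : ℕ} → (x : Fin n → A) →
    Iso (koszulFun M x) (koszul (single A M) (List.ofFn x))
  | 0, x => koszulFunZeroIso M x
  | _ + 1, x => by
    rw [List.ofFn_succ]
    exact (koszulFunIso M x).trans ((koszulFunIsoKoszul M fun j => x j.succ).cone (x 0))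

end GradedDiff

theorem Ideal.exists_mul_pow_mem_of_forall_isPrime {A : Type*} [CommRing A] (I p : Ideal A)
    [p.IsPrime] (b : A) (h : ∀ q : Ideal A, q.IsPrime → I ≤ q → q ≤ p → b ∈ q) :
    ∃ s ∈ p.primeCompl, ∃ N : ℕ, s * b ^ N ∈ I := by
  by_contra! hcon
  obtain ⟨q, hq, hIq, hdisj⟩ := Ideal.exists_le_prime_disjoint (I := I)
    (p.primeCompl ⊔ Submonoid.powers b) <| Set.disjoint_left.2 fun x hxI hx => by
      obtain ⟨s, hs, t, ⟨N, rfl⟩, rfl⟩ := Submonoid.mem_sup.1 hx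
      exact hcon s hs N hxI
  refine Set.disjoint_left.1 hdisj (h q hq hIq fun x hx => ?_)
    (Submonoid.mem_sup_right (Submonoid.mem_powers b))
  by_contra hxp
  exact Set.disjoint_left.1 hdisj hx (Submonoid.mem_sup_left hxp)

/-- A local form of Kronecker's theorem: if chains of primes from `I` up to `p` have length at most
`b.length`, then `a, b` can be replaced by as many elements as in `b`. -/
theorem PrimeSpectrum.exists_list_of_length_le {A : Type*} [CommRing A]
    (p : PrimeSpectrum A) {a : A}
    (ha : a ∈ p.asIdeal) (b : List A) (hb : ∀ v ∈ b, v ∈ p.asIdeal) (I : Ideal A)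
    (hI : ∀ l : LTSeries (PrimeSpectrum A), l.last = p → I ≤ l.head.asIdeal →
      l.length ≤ b.length) :
    ∃ y : List A, y.length = b.length ∧ (∀ u ∈ y, u ∈ p.asIdeal) ∧
      (∀ q : PrimeSpectrum A, q ≤ p → I ≤ q.asIdeal → (∀ u ∈ y, u ∈ q.asIdeal) → a ∈ q.asIdeal) ∧
      ∀ q : PrimeSpectrum A, a ∈ q.asIdeal → (∀ u ∈ y, u ∈ q.asIdeal) →
        ∀ v ∈ b, v ∈ q.asIdeal := by
  induction b generalizing I with
  | nil =>
    refine ⟨[], rfl, by simp, fun q hq hIq _ => ?_, by simp⟩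
    rcases hq.eq_or_lt with rfl | hlt
    · exact ha
    · obtain ⟨l, hl, hlp, hpl⟩ : ∃ l : LTSeries (PrimeSpectrum A),
          l.length = 0 ∧ l.head = p ∧ l.last = p := ⟨RelSeries.singleton _ p, rfl, rfl, rfl⟩
      have := hI (l.cons q (hlp ▸ hlt)) (by simpa using hpl) (by simpa using hIq)
      simp at this
  | cons v b ih =>
    set K : Ideal A := Submodule.comap (LinearMap.mulLeft A v) I.radical with hK
    have hmemK : ∀ x, x ∈ K ↔ v * x ∈ I.radical := fun x => Iff.rfl
    obtain ⟨y, hlen, hyp, hya, hyb⟩ := ih (fun u hu => hb u (List.mem_cons_of_mem _ hu))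
      (I ⊔ Ideal.span {v} ⊔ K) <| by
        intro l hl hIl
        rw [sup_le_iff, sup_le_iff, Ideal.span_singleton_le_iff_mem] at hIl
        obtain ⟨⟨hIl, hvl⟩, hKl⟩ := hIl
        obtain ⟨q, hq, hIq, hql, hvq⟩ : ∃ q : Ideal A, q.IsPrime ∧ I ≤ q ∧
            q ≤ l.head.asIdeal ∧ v ∉ q := by
          by_contra! hcon
          obtain ⟨s, hs, N, hN⟩ :=
            Ideal.exists_mul_pow_mem_of_forall_isPrime I l.head.asIdeal v hcon
          refine hs (hKl ((hmemK s).2 ⟨N + 1, ?_⟩))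
          have : (v * s) ^ (N + 1) = v * s ^ N * (s * v ^ N) := by ring
          rw [this]
          exact I.mul_mem_left _ hN
        have hlt : (⟨q, hq⟩ : PrimeSpectrum A) < l.head :=
          lt_of_le_of_ne hql fun h => hvq (by rw [← h] at hvl; exact hvl)
        simpa using hI (l.cons ⟨q, hq⟩ hlt) (by simpa using hl) (by simpa using hIq)
    obtain ⟨s, hs, N, hN⟩ := Ideal.exists_mul_pow_mem_of_forall_isPrime
      (I ⊔ Ideal.span {v} ⊔ K ⊔ Ideal.span {u | u ∈ y}) p.asIdeal a fun q hq hIq hqp =>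
        hya ⟨q, hq⟩ hqp (le_sup_left.trans hIq) fun u hu =>
          hIq (Submodule.mem_sup_right (Ideal.subset_span hu))
    obtain ⟨k, hk, w, hw, hkw⟩ := Submodule.mem_sup.1 hN
    obtain ⟨m, hm, x, hx, rfl⟩ := Submodule.mem_sup.1 hk
    refine ⟨(v + a * x) :: y, by simpa using hlen, ?_, ?_, ?_⟩
    · rw [List.forall_mem_cons]
      exact ⟨add_mem (hb v List.mem_cons_self) (Ideal.mul_mem_right _ _ ha), hyp⟩
    · intro q hqp hIq hyq
      rw [List.forall_mem_cons] at hyq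
      obtain ⟨hvx, hyq⟩ := hyq
      by_contra haq
      have hvxq : v * x ∈ q.asIdeal := q.isPrime.radical_le_iff.2 hIq ((hmemK x).1 hx)
      obtain ⟨hvq, hxq⟩ : v ∈ q.asIdeal ∧ x ∈ q.asIdeal := by
        rcases q.isPrime.mem_or_mem hvxq with h | h
        · exact ⟨h, (q.isPrime.mem_or_mem ((Ideal.add_mem_iff_right _ h).1 hvx)).resolve_left haq⟩
        · exact ⟨(Ideal.add_mem_iff_left _ (Ideal.mul_mem_left _ _ h)).1 hvx, h⟩
      have hmq : m ∈ q.asIdeal :=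
        (sup_le hIq ((Ideal.span_singleton_le_iff_mem _).2 hvq) : I ⊔ Ideal.span {v} ≤ _) hm
      have hwq : w ∈ q.asIdeal := Ideal.span_le.2 (fun u hu => hyq u hu) hw
      have hsq : s * a ^ N ∈ q.asIdeal := hkw ▸ add_mem (add_mem hmq hxq) hwq
      rcases q.isPrime.mem_or_mem hsq with h | h
      · exact hs (hqp h)
      · exact haq (q.isPrime.mem_of_pow_mem _ h)
    · intro q haq hyq
      rw [List.forall_mem_cons] at hyq ⊢
      exact ⟨(Ideal.add_mem_iff_left _ (Ideal.mul_mem_right _ _ haq)).1 hyq.1,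
        hyb q haq hyq.2⟩

/-- Below a prime of height at most `n`, finitely generated ideals contained in it are generated up
to radical by `n` elements. -/
theorem PrimeSpectrum.exists_list_length_eq_of_height_le {A : Type*} [CommRing A]
    (p : PrimeSpectrum A) {n : ℕ} (hp : Order.height p ≤ n) (l : List A)
    (hl : ∀ a ∈ l, a ∈ p.asIdeal) :
    ∃ y : List A, y.length = n ∧ (∀ u ∈ y, u ∈ p.asIdeal) ∧
      ∀ q : PrimeSpectrum A, q ≤ p → (∀ u ∈ y, u ∈ q.asIdeal) → ∀ a ∈ l, a ∈ q.asIdeal := by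
  induction l with
  | nil => exact ⟨List.replicate n 0, by simp, fun u hu => by simp [List.eq_of_mem_replicate hu],
      by simp⟩
  | cons a l ih =>
    rw [List.forall_mem_cons] at hl
    obtain ⟨b, hbn, hb, hbl⟩ := ih hl.2
    obtain ⟨y, hyb, hy, hya, hyl⟩ := p.exists_list_of_length_le hl.1 b hb ⊥ fun s hs _ => by
      rw [hbn]
      exact_mod_cast Order.height_le_iff'.1 hp hs
    refine ⟨y, hyb.trans hbn, hy, fun q hq hyq => ?_⟩
    have haq := hya q hq bot_le hyq
    rw [List.forall_mem_cons]
    exact ⟨haq, hbl q hq (hyl q haq hyq)⟩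

theorem Order.height_apply_le_of_forall_lt {α β : Type*} [Preorder α] [Preorder β] {g : α → β}
    (hg : ∀ a, ∀ b < g a, ∃ a' < a, g a' = b) (a : α) : Order.height (g a) ≤ Order.height a := by
  refine Order.height_le fun l hl => ?_
  induction hn : l.length generalizing l a with
  | zero => simp
  | succ n ih =>
    obtain ⟨a', ha', hga'⟩ := hg a l.eraseLast.last
      (hl ▸ l.eraseLast_last_rel_last (by lia))
    have := ih a' l.eraseLast hga'.symm (by simp [hn])
    push_cast
    exact (add_le_add_left this 1).trans (Order.height_add_one_le ha')

section Comparison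

variable {A : Type*} [CommRing A] {M : Type*} [AddCommGroup M] [Module A M] {n : ℕ}

open GradedDiff

theorem koszulMap_restrict_apply (x : Fin n → A) (i : ℕ) (g : Finset (Fin n) → M)
    (t : {s : Finset (Fin n) // s.card = i + 1}) :
    koszulMap A M x i (fun s => g s.1) t =
      (show Finset (Fin n) → M from (koszulFun M x).d g) t.1 :=
  Finset.sum_attach t.1 fun j =>
    (((-1 : A) ^ ((t.1.filter (fun k => k < j)).card)) * x j) • g (t.1.erase j)

theorem koszulMap_restrict_eq_iff {x : Fin n → A} {i : ℕ} {h g : Finset (Fin n) → M}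
    (hh : h ∈ (koszulFun M x).deg i) (hg : g ∈ (koszulFun M x).deg (i + 1)) :
    koszulMap A M x i (fun s => h s.1) = (fun s => g s.1) ↔ (koszulFun M x).d h = g := by
  rw [mem_koszulFun_deg] at hh hg
  constructor
  · intro heq
    funext t
    by_cases ht : t.card = i + 1
    · rw [← congrFun heq ⟨t, ht⟩, koszulMap_restrict_apply]
    · refine Eq.trans ?_ (hg t (by lia)).symm
      refine (koszulFun_d_apply x h t).trans (Finset.sum_eq_zero fun j hj => ?_)
      rw [hh, smul_zero]
      have := Finset.card_erase_add_one hj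
      lia
  · rintro rfl
    funext t
    exact koszulMap_restrict_apply x i h t

theorem exists_mem_deg_restrict_eq (x : Fin n → A) {i : ℕ}
    (g : {s : Finset (Fin n) // s.card = i} → M) :
    ∃ h : Finset (Fin n) → M, h ∈ (koszulFun M x).deg i ∧ (fun s => h s.1) = g := by
  refine ⟨fun s => if hs : s.card = i then g ⟨s, hs⟩ else 0, ?_, funext fun s => dif_pos s.2⟩
  exact mem_koszulFun_deg.2 fun t ht => dif_neg (by exact_mod_cast ht)

theorem koszulFun_eq_zero_of_restrict_eq_zero {x : Fin n → A} {i : ℕ} {g : Finset (Fin n) → M}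
    (hg : g ∈ (koszulFun M x).deg i)
    (h : (fun s : {s : Finset (Fin n) // s.card = i} => g s.1) = 0) : g = 0 := by
  funext t
  by_cases ht : t.card = i
  · exact congrFun h ⟨t, ht⟩
  · exact mem_koszulFun_deg.1 hg t (by exact_mod_cast ht)

theorem koszulFun_eq_zero_of_neg {x : Fin n → A} {i : ℤ} (hi : i < 0) {g : Finset (Fin n) → M}
    (hg : g ∈ (koszulFun M x).deg i) : g = 0 :=
  funext fun t => mem_koszulFun_deg.1 hg t (by lia)

theorem not_koszulCohomologyNeZero_iff (x : Fin n → A) (k : ℕ) :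
    ¬ koszulCohomologyNeZero A M x k ↔ (koszulFun M x).ExactAt ⊥ k := by
  cases k with
  | zero =>
    rw [koszulCohomologyNeZero, not_not, eq_bot_iff, exactAt_bot_iff]
    constructor
    · intro hker g hg hdg
      have hg0 := koszulFun_eq_zero_of_restrict_eq_zero hg <| (Submodule.mem_bot A).1 <|
        hker <| LinearMap.mem_ker.2 <|
          (koszulMap_restrict_eq_iff (g := 0) hg (zero_mem _)).2 hdg
      subst hg0
      exact ⟨0, zero_mem _, map_zero _⟩
    · intro hex g' hg'
      obtain ⟨g, hg, rfl⟩ := exists_mem_deg_restrict_eq x g'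
      obtain ⟨h, hh, hd⟩ := hex g hg
        ((koszulMap_restrict_eq_iff (g := 0) hg (zero_mem _)).1 hg')
      obtain rfl := koszulFun_eq_zero_of_neg (by simp) hh
      have : g = 0 := hd.symm.trans (map_zero (koszulFun M x).d)
      subst this
      exact zero_mem _
  | succ k =>
    rw [koszulCohomologyNeZero, not_not, exactAt_bot_iff]
    have e : ((k + 1 : ℕ) : ℤ) - 1 = k := by lia
    rw [e]
    constructor
    · intro hker g hg hdg
      obtain ⟨h', hh'⟩ := hker <| LinearMap.mem_ker.2 <|
        (koszulMap_restrict_eq_iff (g := 0) hg (zero_mem _)).2 hdg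
      obtain ⟨h, hh, rfl⟩ := exists_mem_deg_restrict_eq x h'
      exact ⟨h, hh, (koszulMap_restrict_eq_iff hh (by exact_mod_cast hg)).1 hh'⟩
    · intro hex g' hg'
      obtain ⟨g, hg, rfl⟩ := exists_mem_deg_restrict_eq x g'
      obtain ⟨h, hh, hd⟩ := hex g hg
        ((koszulMap_restrict_eq_iff (g := 0) hg (zero_mem _)).1 hg')
      exact ⟨fun s => h s.1,
        (koszulMap_restrict_eq_iff hh (by exact_mod_cast hg)).2 hd⟩

theorem GradedDiff.ExactAt.mono {S T : Submonoid A} (hST : S ≤ T) {C : GradedDiff A} {i : ℤ}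
    (h : C.ExactAt S i) : C.ExactAt T i := fun g hg hd =>
  let ⟨s, hs, r⟩ := h g hg hd
  ⟨s, hST hs, r⟩

theorem exactAt_koszul_of_lt_kgrSeq {x : Fin n → A} {k : ℕ} (hk : (k : ℕ∞) < kgrSeq A M x) :
    ∀ i ≤ (k : ℤ), (koszul (single A M) (List.ofFn x)).ExactAt ⊥ i := by
  intro i hi
  refine ExactAt.of_iso (koszulFunIsoKoszul M x) ?_
  rcases lt_or_ge i 0 with h0 | h0
  · exact exactAt_bot_iff.2 fun g hg _ =>
      ⟨0, zero_mem _, (map_zero _).trans (koszulFun_eq_zero_of_neg h0 hg).symm⟩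
  · lift i to ℕ using h0
    refine (not_koszulCohomologyNeZero_iff x i).1 fun h => ?_
    refine (hk.trans_le (sInf_le ⟨i, rfl, h⟩)).not_ge ?_
    exact_mod_cast hi

theorem le_kgrSeq_of_exactAt {x : Fin n → A} {c : ℕ∞}
    (h : ∀ k : ℕ, (k : ℕ∞) < c → (koszulFun M x).ExactAt ⊥ k) : c ≤ kgrSeq A M x := by
  refine le_sInf ?_
  rintro _ ⟨k, rfl, hk⟩
  by_contra! hlt
  exact (not_koszulCohomologyNeZero_iff x k).2 (h k hlt) hk

theorem kgrSeq_le_kgrSeq_of_mem_span {m : ℕ} {z : Fin m → A} {x : Fin n → A}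
    (h : ∀ j, z j ∈ Ideal.span (Set.range x)) : kgrSeq A M z ≤ kgrSeq A M x := by
  refine le_kgrSeq_of_exactAt fun k hk => ?_
  refine (exactAt_koszul_of_mem_radical (fun a ha => ?_) (exactAt_koszul_of_lt_kgrSeq hk) k
    le_rfl).of_iso (koszulFunIsoKoszul M x).symm
  obtain ⟨j, rfl⟩ := List.mem_ofFn.1 ha
  refine ⟨1, one_mem _, 1, ?_⟩
  have : {b | b ∈ List.ofFn x} = Set.range x := by ext; simp [List.mem_ofFn]
  rw [this, one_mul, pow_one]
  exact h j

end Comparison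

/-- The Koszul grade of an ideal is at most its height. -/
theorem kgr_le_idealHeight {A : Type*} [CommRing A] (𝔞 : Ideal A) :
    kgr A 𝔞 A ≤ idealHeight A 𝔞 := by
  refine le_iInf₂ fun p hp => iSup_le fun n => iSup₂_le fun x hx => ?_
  by_contra! hlt
  obtain ⟨h, hh⟩ := ENat.ne_top_iff_exists.1 (hlt.trans_le le_top).ne
  rw [← hh] at hlt
  obtain ⟨y, rfl, hyp, hy⟩ :=
    p.exists_list_length_eq_of_height_le hh.ge (List.ofFn x) fun a ha => by
      obtain ⟨j, rfl⟩ := List.mem_ofFn.1 ha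
      exact hp (hx j)
  obtain ⟨s, hs, hsy⟩ := GradedDiff.exists_mem_span_of_exactAt_koszul <|
    GradedDiff.exactAt_koszul_of_mem_radical (S := p.asIdeal.primeCompl) (l := List.ofFn x) (y := y)
      (fun a ha => Ideal.exists_mul_pow_mem_of_forall_isPrime _ _ _ fun q hq hyq hqp =>
        hy ⟨q, hq⟩ hqp (fun u hu => hyq (Ideal.subset_span hu)) a ha)
      (fun i hi => (exactAt_koszul_of_lt_kgrSeq hlt i hi).mono bot_le) _ le_rfl
  exact hs (Ideal.span_le.2 hyp hsy)

section BaseChange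

open GradedDiff

variable {A R : Type*} [CommRing A] [CommRing R] {φ : A →+* R} {M N : Type*}
  [AddCommGroup M] [Module A M] [AddCommGroup N] [Module R N] {ι : M →+ N} {ρ : N →+ M}

theorem GradedDiff.ExactAt.of_retract {n : ℕ} {x : Fin n → A} {k : ℤ}
    (hρι : ∀ m, ρ (ι m) = m) (hι : ∀ a m, ι (a • m) = φ a • ι m)
    (hρ : ∀ a m, ρ (φ a • m) = a • ρ m)
    (h : (koszulFun N (fun j => φ (x j))).ExactAt ⊥ k) : (koszulFun M x).ExactAt ⊥ k := by
  rw [exactAt_bot_iff] at h ⊢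
  intro (g : Finset (Fin n) → M) hg hdg
  obtain ⟨(b : Finset (Fin n) → N), hb, hdb⟩ := h (fun t => ι (g t))
    (mem_koszulFun_deg.2 fun t ht => by rw [mem_koszulFun_deg.1 hg t ht, map_zero]) <| by
      funext t
      refine (koszulFun_d_apply _ _ t).trans ?_
      have := (congrArg ι ((koszulFun_d_apply x g t).symm.trans (congrFun hdg t))).trans
        (map_zero ι)
      rw [map_sum] at this
      refine Eq.trans ?_ this
      refine Finset.sum_congr rfl fun j _ => ?_
      rw [hι]
      simp
  refine ⟨fun t => ρ (b t),
    mem_koszulFun_deg.2 fun t ht => by rw [mem_koszulFun_deg.1 hb t ht, map_zero], ?_⟩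
  funext t
  refine (koszulFun_d_apply _ _ t).trans ?_
  have := congrArg ρ ((koszulFun_d_apply _ b t).symm.trans (congrFun hdb t))
  rw [map_sum, hρι] at this
  rw [← this]
  refine Finset.sum_congr rfl fun j _ => ?_
  rw [← hρ]
  simp

theorem Ideal.exists_list_of_mem_map {𝔞 : Ideal A} {z : R} (hz : z ∈ 𝔞.map φ) :
    ∃ l : List A, (∀ a ∈ l, a ∈ 𝔞) ∧ z ∈ Ideal.span (φ '' {a | a ∈ l}) := by
  induction hz using Submodule.span_induction with
  | mem z hz =>
    obtain ⟨a, ha, rfl⟩ := hz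
    exact ⟨[a], by simpa using ha, Ideal.subset_span ⟨a, by simp, rfl⟩⟩
  | zero => exact ⟨[], by simp, zero_mem _⟩
  | add y z _ _ hy hz =>
    obtain ⟨l, hl, hy⟩ := hy
    obtain ⟨l', hl', hz⟩ := hz
    refine ⟨l ++ l', fun a ha => (List.mem_append.1 ha).elim (hl a) (hl' a), add_mem ?_ ?_⟩
    · exact Ideal.span_mono (Set.image_mono fun a ha => List.mem_append_left _ ha) hy
    · exact Ideal.span_mono (Set.image_mono fun a ha => List.mem_append_right _ ha) hz
  | smul c z _ hz =>
    obtain ⟨l, hl, hz⟩ := hz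
    exact ⟨l, hl, Ideal.mul_mem_left _ _ hz⟩

theorem kgr_map_le_of_retract (𝔞 : Ideal A)
    (hρι : ∀ m, ρ (ι m) = m) (hι : ∀ a m, ι (a • m) = φ a • ι m)
    (hρ : ∀ a m, ρ (φ a • m) = a • ρ m) : kgr R (𝔞.map φ) N ≤ kgr A 𝔞 M := by
  refine iSup_le fun n => iSup₂_le fun z hz => ?_
  choose L hL hzL using fun j => Ideal.exists_list_of_mem_map (hz j)
  set l := (List.ofFn L).flatten with hl
  have hmem : ∀ a ∈ l, a ∈ 𝔞 := fun a ha => by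
    obtain ⟨l', hl', ha⟩ := List.mem_flatten.1 ha
    obtain ⟨j, rfl⟩ := List.mem_ofFn.1 hl'
    exact hL j a ha
  have hspan : ∀ j, z j ∈ Ideal.span (Set.range fun i => φ (l.get i)) := fun j => by
    refine Ideal.span_mono ?_ (hzL j)
    rintro _ ⟨a, ha, rfl⟩
    obtain ⟨i, hi⟩ := List.mem_iff_get.1
      (List.mem_flatten.2 ⟨L j, List.mem_ofFn.2 ⟨j, rfl⟩, ha⟩ : a ∈ l)
    exact ⟨i, congrArg φ hi⟩
  calc kgrSeq R N z ≤ kgrSeq R N (fun i => φ (l.get i)) := kgrSeq_le_kgrSeq_of_mem_span hspan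
    _ ≤ kgrSeq A M l.get := le_kgrSeq_of_exactAt fun k hk =>
      GradedDiff.ExactAt.of_retract hρι hι hρ <|
        (exactAt_koszul_of_lt_kgrSeq hk k le_rfl).of_iso (GradedDiff.koszulFunIsoKoszul N _).symm
    _ ≤ kgr A 𝔞 M := le_iSup_of_le _ (le_iSup₂_of_le _ (fun j => hmem _ (l.get_mem j)) le_rfl)

end BaseChange

theorem RingHom.GoesDown.idealHeight_le_idealHeight_map {A B : Type*} [CommRing A] [CommRing B]
    {f : A →+* B} (hf : f.GoesDown) (𝔞 : Ideal A) :
    idealHeight A 𝔞 ≤ idealHeight B (𝔞.map f) := by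
  refine le_iInf₂ fun q hq =>
    (iInf₂_le (PrimeSpectrum.comap f q) (Ideal.map_le_iff_le_comap.1 hq)).trans ?_
  refine Order.height_apply_le_of_forall_lt (g := PrimeSpectrum.comap f) (fun q p hp => ?_) q
  obtain ⟨q', hq', hle, hcomap⟩ := hf p.asIdeal _ p.isPrime (PrimeSpectrum.comap f q).isPrime hp.le
    q.asIdeal q.isPrime rfl
  have heq : PrimeSpectrum.comap f ⟨q', hq'⟩ = p := PrimeSpectrum.ext hcomap
  refine ⟨⟨q', hq'⟩, lt_of_le_of_ne hle ?_, heq⟩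
  rintro rfl
  exact hp.ne heq.symm

section Amalgamation

variable {A B : Type*} [CommRing A] [CommRing B] (f : A →+* B) (J : Ideal B)

/-- The embedding `j ↦ (0, j)` of `J` into the amalgamation. -/
def amalgInr : J →+ amalgamation f J where
  toFun j := ⟨(0, j), show (j : B) - f 0 ∈ J by simp⟩
  map_zero' := rfl
  map_add' j k := Subtype.ext (by simp)

/-- The projection `(a, f a + j) ↦ j` of the amalgamation onto `J`. -/
def amalgSnd : amalgamation f J →+ J where
  toFun z := ⟨z.1.2 - f z.1.1, z.2⟩
  map_zero' := Subtype.ext (by simp)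
  map_add' y z := Subtype.ext (by simp [add_sub_add_comm])

theorem eq_amalgIota_add_amalgInr (z : amalgamation f J) :
    z = amalgIota f J z.1.1 + amalgInr f J (amalgSnd f J z) :=
  Subtype.ext (Prod.ext (add_zero _).symm (add_sub_cancel _ _).symm)

theorem kgr_idealExt_le_kgr (𝔞 : Ideal A) :
    kgr (amalgamation f J) (idealExt f J 𝔞) (amalgamation f J) ≤ kgr A 𝔞 A :=
  kgr_map_le_of_retract (φ := amalgIota f J) (ι := (amalgIota f J).toAddMonoidHom)
    (ρ := ((RingHom.fst A B).comp (amalgamation f J).subtype).toAddMonoidHom) 𝔞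
    (fun _ => rfl) (fun a m => map_mul (amalgIota f J) a m) (fun _ _ => rfl)

theorem kgr_idealExt_le_kgrIdeal (𝔞 : Ideal A) :
    kgr (amalgamation f J) (idealExt f J 𝔞) (amalgamation f J) ≤ kgrIdeal f J 𝔞 := by
  let : Module A J := Module.compHom J f
  refine kgr_map_le_of_retract (φ := amalgIota f J) (ι := amalgInr f J) (ρ := amalgSnd f J) 𝔞
    (fun m => Subtype.ext ?_) (fun a m => Subtype.ext (Prod.ext ?_ rfl))
    (fun a m => Subtype.ext ?_)
  · change (m : B) - f 0 = m
    simp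
  · exact (mul_zero a).symm
  · change f a * m.1.2 - f (a * m.1.1) = f a * (m.1.2 - f m.1.1)
    rw [map_mul, mul_sub]

variable {f}

/-- The embedding of `A` into the amalgamation inherits going-down. -/
theorem RingHom.GoesDown.amalgIota (hf : f.GoesDown) : (amalgIota f J).GoesDown := by
  intro P' P hP' hP hle Q hQ hQP
  by_cases hJ : ∀ j, amalgInr f J j ∈ Q
  · refine ⟨P'.comap ((RingHom.fst A B).comp (amalgamation f J).subtype), inferInstance, ?_, rfl⟩
    intro z hz
    rw [eq_amalgIota_add_amalgInr f J z]
    refine add_mem ?_ (hJ _)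
    have : z.1.1 ∈ Q.comap (_root_.amalgIota f J) := hQP ▸ hle hz
    exact this
  · push Not at hJ
    obtain ⟨j, hj⟩ := hJ
    have hmul : ∀ z : amalgamation f J, z * amalgInr f J j =
        amalgInr f J ⟨z.1.2 * j, J.mul_mem_left _ j.2⟩ := fun z =>
      Subtype.ext (Prod.ext (mul_zero _) rfl)
    have hprod : ∀ b c : B, amalgInr f J ⟨b * j, J.mul_mem_left _ j.2⟩ *
        amalgInr f J ⟨c * j, J.mul_mem_left _ j.2⟩ =
        amalgInr f J ⟨b * c * j, J.mul_mem_left _ j.2⟩ * amalgInr f J j := fun b c =>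
      Subtype.ext (Prod.ext (by simp [amalgInr]) (by simp [amalgInr]; ring))
    let q : Ideal B :=
      { carrier := {b | amalgInr f J ⟨b * j, J.mul_mem_left _ j.2⟩ ∈ Q}
        zero_mem' := by
          have : (⟨0 * j, J.mul_mem_left _ j.2⟩ : J) = 0 := Subtype.ext (zero_mul _)
          change amalgInr f J ⟨0 * j, _⟩ ∈ Q
          rw [this, map_zero]
          exact zero_mem _
        add_mem' := fun {b c} hb hc => by
          have : (⟨(b + c) * j, J.mul_mem_left _ j.2⟩ : J) =
            ⟨b * j, J.mul_mem_left _ j.2⟩ + ⟨c * j, J.mul_mem_left _ j.2⟩ :=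
              Subtype.ext (add_mul _ _ _)
          change amalgInr f J ⟨(b + c) * j, _⟩ ∈ Q
          rw [this, map_add]
          exact Q.add_mem hb hc
        smul_mem' := fun c b hb => by
          have := Q.mul_mem_left (amalgInr f J ⟨c * j, J.mul_mem_left _ j.2⟩) hb
          rw [hprod] at this
          exact (hQ.mem_or_mem this).resolve_right hj }
    have hmem : ∀ b, b ∈ q ↔ amalgInr f J ⟨b * j, J.mul_mem_left _ j.2⟩ ∈ Q := fun _ => Iff.rfl
    have hmem' : ∀ z : amalgamation f J, z.1.2 ∈ q ↔ z ∈ Q := fun z => by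
      rw [hmem, ← hmul]
      exact ⟨fun h => (hQ.mem_or_mem h).resolve_right hj, fun h => Q.mul_mem_right _ h⟩
    have hq : q.IsPrime := by
      refine ⟨fun h => hj ?_, fun {b c} h => ?_⟩
      · have : (1 : B) ∈ q := h ▸ Submodule.mem_top
        simpa [hmem] using this
      · have := Q.mul_mem_right (amalgInr f J j) ((hmem _).1 h)
        rw [← hprod] at this
        exact hQ.mem_or_mem this
    have hqP : q.comap f = P := by
      rw [← hQP]
      exact Ideal.ext fun a => hmem' (_root_.amalgIota f J a)
    obtain ⟨q', hq', hle', hq'P⟩ := hf P' P hP' hP hle q hq hqP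
    exact ⟨q'.comap ((RingHom.snd A B).comp (amalgamation f J).subtype), inferInstance,
      fun z hz => (hmem' z).1 (hle' hz), hq'P⟩

end Amalgamation

/-- Assume `f : A → B` satisfies the going-down property and let `𝒜` be
a non-empty class of ideals of `A`. If `A⋈^f J` is Cohen-Macaulay in the sense of `𝒜^e`,
then `A` is Cohen-Macaulay in the sense of `𝒜` and `kgr_A(𝔞, J) ≥ height 𝔞` for every
`𝔞 ∈ 𝒜`. -/
theorem isCMSense_of_isCMSense_ext_of_goesDown {A B : Type*} [CommRing A] [CommRing B]
    (f : A →+* B) (J : Ideal B) (hgd : f.GoesDown) (𝒜 : Set (Ideal A))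
    (h𝒜 : 𝒜.Nonempty)
    (hCM : IsCMSense ↥(amalgamation f J) (idealExt f J '' 𝒜)) :
    IsCMSense A 𝒜 ∧ ∀ 𝔞 ∈ 𝒜, idealHeight A 𝔞 ≤ kgrIdeal f J 𝔞 := by
  have key : ∀ 𝔞 ∈ 𝒜, idealHeight A 𝔞 ≤
      kgr (amalgamation f J) (idealExt f J 𝔞) (amalgamation f J) := fun 𝔞 h𝔞 =>
    ((hgd.amalgIota J).idealHeight_le_idealHeight_map 𝔞).trans (hCM _ ⟨𝔞, h𝔞, rfl⟩).le
  exact ⟨fun 𝔞 h𝔞 => le_antisymm ((key 𝔞 h𝔞).trans (kgr_idealExt_le_kgr f J 𝔞))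
      (kgr_le_idealHeight 𝔞),
    fun 𝔞 h𝔞 => (key 𝔞 h𝔞).trans (kgr_idealExt_le_kgrIdeal f J 𝔞)⟩
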